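/- arXiv:1605.02882 — 3 statements merged into one kernel-verified Lean document; each statement's English description precedes it below -/
import Mathlib

section
/- Let 𝒱 = {v₁,…,v_h} be a finite collection of vectors in ℝ^n, and for each v ∈ 𝒱 let β_v ≥ 0 be a nonnegative real multiplier. Define the symmetric n×n matrix B = ∑_{v∈𝒱} β_v ( v vᵀ − 2 ∑_{i=1}^n ⟨v,e_i⟩² e_i e_iᵀ ), where e₁,…,e_n is the standard basis of ℝ^n. Then there exists a linear subspace W of ℝ^n with dim(W) ≥ n/2 such that yᵀ B y ≤ 0 for every y ∈ W. -/
/-- spectral expansion of a real quadratic form -/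
lemma quad_expand {n : ℕ} {C : Matrix (Fin n) (Fin n) ℝ} (hC : C.IsHermitian) (z : Fin n → ℝ) :
    z ⬝ᵥ C.mulVec z
      = ∑ j, hC.eigenvalues j * ((hC.eigenvectorBasis j).ofLp ⬝ᵥ z) ^ 2 := by
  have h := hC.eigenvectorBasis.sum_inner_mul_inner (WithLp.toLp 2 z) (WithLp.toLp 2 (C.mulVec z))
  simp only [EuclideanSpace.inner_eq_star_dotProduct, star_trivial] at h
  rw [dotProduct_comm, ← h]
  refine Finset.sum_congr rfl fun j _ => ?_
  have hT : C.transpose = C := by simpa using hC.eq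
  have h2 : C.mulVec z ⬝ᵥ (hC.eigenvectorBasis j).ofLp
      = hC.eigenvalues j * ((hC.eigenvectorBasis j).ofLp ⬝ᵥ z) := by
    rw [dotProduct_comm, Matrix.dotProduct_mulVec, ← Matrix.mulVec_transpose, hT,
      hC.mulVec_eigenvectorBasis, smul_dotProduct, smul_eq_mul]
  rw [h2]; ring

lemma norm_expand {n : ℕ} {C : Matrix (Fin n) (Fin n) ℝ} (hC : C.IsHermitian) (z : Fin n → ℝ) :
    z ⬝ᵥ z = ∑ j, ((hC.eigenvectorBasis j).ofLp ⬝ᵥ z) ^ 2 := by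
  have h := hC.eigenvectorBasis.sum_inner_mul_inner (WithLp.toLp 2 z) (WithLp.toLp 2 z)
  simp only [EuclideanSpace.inner_eq_star_dotProduct, star_trivial] at h
  rw [← h]
  refine Finset.sum_congr rfl fun j _ => ?_
  rw [dotProduct_comm z]; ring

/-- quadratic form of a weighted sum of rank-one matrices -/
lemma quad_sum {n h : ℕ} (w : Fin h → (Fin n → ℝ)) (β : Fin h → ℝ) (z : Fin n → ℝ) :
    z ⬝ᵥ (∑ k, β k • Matrix.vecMulVec (w k) (w k)).mulVec z
      = ∑ k, β k * (w k ⬝ᵥ z) ^ 2 := by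
  rw [Matrix.sum_mulVec, dotProduct_sum]
  refine Finset.sum_congr rfl fun k _ => ?_
  rw [Matrix.smul_mulVec, dotProduct_smul, Matrix.vecMulVec_mulVec]
  rw [dotProduct_smul, dotProduct_comm z, MulOpposite.smul_eq_mul_unop, MulOpposite.unop_op,
    smul_eq_mul]
  ring


/-- For vectors `v₁,…,v_h ∈ ℝⁿ` with nonnegative multipliers `β_v`, the matrix
`B = ∑_v β_v (v vᵀ − 2 ∑ᵢ ⟨v,eᵢ⟩² eᵢeᵢᵀ)` is negative semidefinite on some
subspace `W` of dimension at least `n/2`. -/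
theorem negative_semidefinite_subspace (n h : ℕ) (v : Fin h → (Fin n → ℝ))
    (β : Fin h → ℝ) (hβ : ∀ k, 0 ≤ β k) :
    ∃ W : Submodule ℝ (Fin n → ℝ),
      (n : ℝ) / 2 ≤ (Module.finrank ℝ W : ℝ) ∧
      ∀ y ∈ W,
        dotProduct y
          ((∑ k : Fin h, β k •
              (Matrix.vecMulVec (v k) (v k) -
                2 • Matrix.diagonal (fun i => (v k i) ^ 2))).mulVec y) ≤ 0 := by
  classical
  set d : Fin n → ℝ := fun i => ∑ k, β k * (v k i) ^ 2 with hd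
  have hd0 : ∀ i, 0 ≤ d i := fun i =>
    Finset.sum_nonneg fun k _ => mul_nonneg (hβ k) (sq_nonneg _)
  set s : Fin n → ℝ := fun i => Real.sqrt (d i) with hs
  have hss : ∀ i, s i ^ 2 = d i := fun i => Real.sq_sqrt (hd0 i)
  set w : Fin h → Fin n → ℝ := fun k i => v k i / s i with hw
  set C : Matrix (Fin n) (Fin n) ℝ := ∑ k, β k • Matrix.vecMulVec (w k) (w k) with hCdef
  have hP : C.PosSemidef := by
    refine Matrix.posSemidef_sum _ fun k _ => ?_
    have := (Matrix.posSemidef_vecMulVec_self_star (w k)).smul (hβ k)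
    simpa using this
  have hC : C.IsHermitian := hP.1
  have htr : ∑ j, hC.eigenvalues j ≤ n := by
    have h1 : C.trace = ∑ j, hC.eigenvalues j := by
      simpa using hC.trace_eq_sum_eigenvalues
    rw [← h1, Matrix.trace]
    have h2 : ∀ i, C.diag i ≤ 1 := by
      intro i
      have : C.diag i = d i / s i ^ 2 := by
        simp only [hCdef, Matrix.diag_apply, Matrix.sum_apply, Matrix.smul_apply,
          Matrix.vecMulVec_apply, hw, hd, Finset.sum_div, smul_eq_mul]
        refine Finset.sum_congr rfl fun k _ => ?_
        ring
      rw [this, hss]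
      exact div_self_le_one _
    calc _ ≤ ∑ i : Fin n, (1 : ℝ) := Finset.sum_le_sum fun i _ => h2 i
      _ = n := by simp
  let J := {j : Fin n // 2 < hC.eigenvalues j}
  let L : (Fin n → ℝ) →ₗ[ℝ] (J → ℝ) :=
    { toFun := fun y j => (hC.eigenvectorBasis j.1).ofLp ⬝ᵥ (fun i => s i * y i)
      map_add' := by
        intro x y; ext j
        simp [dotProduct, mul_add, Finset.sum_add_distrib]
      map_smul' := by
        intro c y; ext j
        simp only [dotProduct, Pi.smul_apply, smul_eq_mul, RingHom.id_apply, Finset.mul_sum]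
        exact Finset.sum_congr rfl fun i _ => by ring }
  refine ⟨LinearMap.ker L, ?_, ?_⟩
  · have h1 := L.finrank_range_add_finrank_ker
    have h2 := Submodule.finrank_le (LinearMap.range L)
    rw [Module.finrank_fintype_fun_eq_card] at h1 h2
    rw [Fintype.card_fin] at h1
    have h3 : (2 : ℝ) * Fintype.card J ≤ n := by
      refine le_trans ?_ htr
      have : (2 : ℝ) * Fintype.card J = ∑ j, if 2 < hC.eigenvalues j then (2 : ℝ) else 0 := by
        rw [← Finset.sum_filter, Finset.sum_const, Fintype.card_subtype]
        simp [mul_comm]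
      rw [this]
      refine Finset.sum_le_sum fun j _ => ?_
      split_ifs with hj
      · exact hj.le
      · exact hP.eigenvalues_nonneg j
    have h4 : (n : ℝ) ≤ Fintype.card J + Module.finrank ℝ (LinearMap.ker L) := by
      exact_mod_cast (by omega : n ≤ Fintype.card J + Module.finrank ℝ (LinearMap.ker L))
    linarith
  · intro y hy
    set z : Fin n → ℝ := fun i => s i * y i with hz
    have hy' : ∀ j, 2 < hC.eigenvalues j → (hC.eigenvectorBasis j).ofLp ⬝ᵥ z = 0 := by
      intro j hj
      exact congrFun (LinearMap.mem_ker.1 hy) ⟨j, hj⟩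
    have h1 : z ⬝ᵥ C.mulVec z ≤ 2 * (z ⬝ᵥ z) := by
      rw [quad_expand hC, norm_expand hC, Finset.mul_sum]
      refine Finset.sum_le_sum fun j _ => ?_
      by_cases hj : 2 < hC.eigenvalues j
      · simp [hy' j hj]
      · exact mul_le_mul_of_nonneg_right (not_lt.1 hj) (sq_nonneg _)
    have h2 : z ⬝ᵥ C.mulVec z = ∑ k, β k * (v k ⬝ᵥ y) ^ 2 := by
      rw [hCdef, quad_sum]
      refine Finset.sum_congr rfl fun k _ => ?_
      rcases eq_or_ne (β k) 0 with hb | hb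
      · simp [hb]
      · have : w k ⬝ᵥ z = v k ⬝ᵥ y := by
          refine Finset.sum_congr rfl fun i _ => ?_
          simp only [hw, hz]
          by_cases hsi : s i = 0
          · have hdi : d i = 0 := by rw [← hss, hsi]; simp
            have h5 := (Finset.sum_eq_zero_iff_of_nonneg
              (fun k _ => mul_nonneg (hβ k) (sq_nonneg (v k i)))).1 hdi k (Finset.mem_univ k)
            have h6 : v k i = 0 := by simpa [hb] using h5
            simp [h6]
          · field_simp
        rw [this]
    have h3 : z ⬝ᵥ z = ∑ i, d i * y i ^ 2 := by
      refine Finset.sum_congr rfl fun i _ => ?_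
      rw [← hss]; simp only [hz]; ring
    have h4 : (∑ k : Fin h, β k • (Matrix.vecMulVec (v k) (v k) -
                2 • Matrix.diagonal (fun i => (v k i) ^ 2)))
        = (∑ k, β k • Matrix.vecMulVec (v k) (v k)) - Matrix.diagonal (fun i => 2 * d i) := by
      ext a b
      simp only [Matrix.sub_apply, Matrix.sum_apply, Matrix.smul_apply, Matrix.diagonal_apply,
        smul_eq_mul, mul_sub, Finset.sum_sub_distrib]
      congr 1
      split_ifs with hab
      · simp only [hd, Finset.mul_sum]
        exact Finset.sum_congr rfl fun k _ => by rw [nsmul_eq_mul]; push_cast; ring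
      · simp
    have h5 : y ⬝ᵥ (Matrix.diagonal (fun i => 2 * d i)).mulVec y = 2 * ∑ i, d i * y i ^ 2 := by
      simp only [dotProduct, Matrix.mulVec_diagonal, Finset.mul_sum]
      exact Finset.sum_congr rfl fun i _ => by ring
    rw [h4, Matrix.sub_mulVec, dotProduct_sub, quad_sum, h5]
    linarith
end

section
/- Let ℒ be a finite family of subsets of {1,…,n}. For each S ∈ ℒ, let v_S ∈ ℝ^n be the 0/1 indicator vector of S, let I_S be the diagonal n×n matrix with (I_S)_{ii} = 1 if i ∈ S and 0 otherwise, let x_S ∈ ℝ^n be a vector supported on S whose entries satisfy |(x_S)_i| ≤ 1 for all i, and let β_S ≥ 0 and β_S^x ≥ 0 be nonnegative reals. Define B = ∑_{S∈ℒ} ( β_S (v_S v_Sᵀ − 2 I_S) + β_S^x (x_S x_Sᵀ − 2 I_S) ). Then there exists a linear subspace W of ℝ^n with dim(W) ≥ n/2 such that yᵀ B y ≤ 0 for every y ∈ W. -/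
open Matrix in
/-- Spectral lemma for matrices of trace at most `n`, with a rescaling `s`. -/
theorem aux_spectral {n : ℕ} (M : Matrix (Fin n) (Fin n) ℝ) (hM : M.PosSemidef)
    (htr : M.trace ≤ n) (s : Fin n → ℝ) :
    ∃ W : Submodule ℝ (Fin n → ℝ), (n : ℝ) / 2 ≤ (Module.finrank ℝ W : ℝ) ∧
      ∀ y ∈ W, (s * y) ⬝ᵥ (M *ᵥ (s * y)) ≤ 2 * ∑ i, (s i * y i) ^ 2 := by
  classical
  set U : Matrix (Fin n) (Fin n) ℝ := (hM.1.eigenvectorUnitary : Matrix (Fin n) (Fin n) ℝ) with hU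
  set ev := hM.1.eigenvalues with hev
  have hUU : U * Uᵀ = 1 := by
    have := Unitary.coe_mul_star_self hM.1.eigenvectorUnitary
    simpa [star_eq_conjTranspose] using this
  have hspec : M = U * diagonal ev * Uᵀ := by
    have := hM.1.spectral_theorem
    rw [Unitary.conjStarAlgAut_apply] at this
    simpa [star_eq_conjTranspose] using this
  let f : (Fin n → ℝ) →ₗ[ℝ] ({k : Fin n // 2 < ev k} → ℝ) :=
    { toFun := fun y k => (Uᵀ *ᵥ (s * y)) k.1
      map_add' := by intro a b; ext k; simp [mul_add, mulVec_add]
      map_smul' := by intro a b; ext k; simp [mulVec_smul] }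
  refine ⟨LinearMap.ker f, ?_, ?_⟩
  · have h1 := f.finrank_range_add_finrank_ker
    have h2 := (LinearMap.range f).finrank_le
    simp only [Module.finrank_fintype_fun_eq_card, Fintype.card_fin] at h1 h2
    have h3 : (2 : ℝ) * Fintype.card {k : Fin n // 2 < ev k} ≤ n := by
      have ht : M.trace = ∑ i, ev i := by simpa using hM.1.trace_eq_sum_eigenvalues
      have h5 : ∑ i, (if 2 < ev i then (2 : ℝ) else 0) ≤ ∑ i, ev i := by
        apply Finset.sum_le_sum
        intro i _
        split_ifs with h
        · exact h.le
        · exact hM.eigenvalues_nonneg i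
      rw [← Finset.sum_filter, Finset.sum_const, nsmul_eq_mul] at h5
      rw [Fintype.card_subtype]
      linarith
    have h4 : (n : ℝ) ≤ Fintype.card {k : Fin n // 2 < ev k}
        + (Module.finrank ℝ (LinearMap.ker f) : ℝ) := by
      exact_mod_cast (by omega)
    linarith
  · intro y hy
    have hy' : ∀ k, 2 < ev k → (Uᵀ *ᵥ (s * y)) k = 0 := fun k hk => by
      have := congrFun (LinearMap.mem_ker.1 hy) ⟨k, hk⟩
      simpa [f] using this
    set z := s * y with hz
    set w := Uᵀ *ᵥ z with hw
    have e1 : z ⬝ᵥ (M *ᵥ z) = ∑ k, ev k * w k ^ 2 := by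
      rw [hspec, ← mulVec_mulVec, ← mulVec_mulVec, dotProduct_mulVec, ← mulVec_transpose, ← hw]
      simp only [dotProduct, mulVec_diagonal]
      exact Finset.sum_congr rfl fun k _ => by ring
    have e2 : ∑ i, (s i * y i) ^ 2 = ∑ k, w k ^ 2 := by
      have : w ⬝ᵥ w = z ⬝ᵥ z := by
        conv_lhs => rw [hw]
        rw [dotProduct_mulVec, vecMul_transpose, mulVec_mulVec, hUU, one_mulVec]
      simp only [dotProduct] at this
      simp only [pow_two]
      rw [this]; rfl
    rw [e1, e2, Finset.mul_sum]
    apply Finset.sum_le_sum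
    intro k _
    by_cases h : 2 < ev k
    · simp [hy' k h]
    · exact mul_le_mul_of_nonneg_right (not_lt.1 h) (sq_nonneg _)

open Matrix in
/-- A positive semidefinite matrix whose diagonal is bounded by `d` is at most `2 diag d`
on a subspace of at least half the dimension. -/
theorem aux_main {n : ℕ} (A : Matrix (Fin n) (Fin n) ℝ) (hA : A.PosSemidef)
    (d : Fin n → ℝ) (hd : ∀ i, A i i ≤ d i) :
    ∃ W : Submodule ℝ (Fin n → ℝ), (n : ℝ) / 2 ≤ (Module.finrank ℝ W : ℝ) ∧
      ∀ y ∈ W, y ⬝ᵥ (A *ᵥ y) ≤ 2 * ∑ i, d i * y i ^ 2 := by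
  classical
  have hA0 : ∀ i, 0 ≤ A i i := fun i => hA.diag_nonneg
  have hd0 : ∀ i, 0 ≤ d i := fun i => (hA0 i).trans (hd i)
  set s : Fin n → ℝ := fun i => √(d i) with hs
  have hss : ∀ i, s i * s i = d i := fun i => Real.mul_self_sqrt (hd0 i)
  have hcol : ∀ i, s i = 0 → ∀ j, A j i = 0 := by
    intro i hi j
    have h0 : A i i = 0 := le_antisymm ((hd i).trans (by rw [← hss, hi]; simp)) (hA0 i)
    have := (hA.dotProduct_mulVec_zero_iff (Pi.single i 1)).1 (by simp [h0])
    simpa using congrFun this j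
  have hrow : ∀ i, s i = 0 → ∀ j, A i j = 0 := by
    intro i hi j
    have := hA.1.apply i j
    rw [← this]; simp [hcol i hi j]
  set M := diagonal s⁻¹ * A * diagonal s⁻¹ with hMdef
  have hMe : ∀ i j, M i j = (s i)⁻¹ * A i j * (s j)⁻¹ := fun i j => by
    simp [hMdef, mul_diagonal, diagonal_mul]
  have hM : M.PosSemidef := by
    have := hA.conjTranspose_mul_mul_same (diagonal s⁻¹)
    simpa [diagonal_conjTranspose] using this
  have htr : M.trace ≤ n := by
    have : ∀ i, M i i ≤ 1 := by
      intro i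
      rw [hMe]
      by_cases h : s i = 0
      · simp [h]
      · have hp : 0 < s i := lt_of_le_of_ne (Real.sqrt_nonneg _) (Ne.symm h)
        have := hd i
        rw [← hss] at this
        rw [show (s i)⁻¹ * A i i * (s i)⁻¹ = A i i / (s i * s i) by field_simp]
        exact div_le_one_of_le₀ this (by positivity)
    calc M.trace = ∑ i, M i i := rfl
      _ ≤ ∑ i : Fin n, (1 : ℝ) := Finset.sum_le_sum fun i _ => this i
      _ = n := by simp
  obtain ⟨W, hW, h⟩ := aux_spectral M hM htr s
  refine ⟨W, hW, fun y hy => ?_⟩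
  have := h y hy
  convert this using 1
  · simp only [dotProduct, mulVec, Finset.mul_sum, Pi.mul_apply, hMe]
    refine Finset.sum_congr rfl fun i _ => Finset.sum_congr rfl fun j _ => ?_
    by_cases hi : s i = 0
    · simp [hi, hrow i hi j]
    by_cases hj : s j = 0
    · simp [hj, hcol j hj i]
    field_simp
  · congr 1
    refine Finset.sum_congr rfl fun i _ => ?_
    rw [← hss]; ring


/-- For a finite family `ℒ` of subsets of `{1,…,n}`, indicator vectors `v_S`,
vectors `x_S` supported on `S` with entries in `[-1,1]`, diagonal matrices `I_S`,
and nonnegative multipliers `β_S, β_S^x`, the matrix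
`B = ∑_{S∈ℒ} (β_S (v_S v_Sᵀ − 2 I_S) + β_S^x (x_S x_Sᵀ − 2 I_S))`
is negative semidefinite on some subspace `W` of dimension at least `n/2`. -/
theorem negative_semidefinite_subspace_sets (n : ℕ) (ℒ : Finset (Finset (Fin n)))
    (x : Finset (Fin n) → (Fin n → ℝ))
    (hsupp : ∀ S ∈ ℒ, ∀ i : Fin n, i ∉ S → x S i = 0)
    (hbdd : ∀ S ∈ ℒ, ∀ i : Fin n, |x S i| ≤ 1)
    (β βx : Finset (Fin n) → ℝ)
    (hβ : ∀ S ∈ ℒ, 0 ≤ β S) (hβx : ∀ S ∈ ℒ, 0 ≤ βx S) :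
    ∃ W : Submodule ℝ (Fin n → ℝ),
      (n : ℝ) / 2 ≤ (Module.finrank ℝ W : ℝ) ∧
      ∀ y ∈ W,
        dotProduct y
          ((∑ S ∈ ℒ,
              (β S • (Matrix.vecMulVec (fun i => if i ∈ S then (1 : ℝ) else 0)
                        (fun i => if i ∈ S then (1 : ℝ) else 0) -
                      2 • Matrix.diagonal (fun i => if i ∈ S then (1 : ℝ) else 0)) +
               βx S • (Matrix.vecMulVec (x S) (x S) -
                      2 • Matrix.diagonal (fun i => if i ∈ S then (1 : ℝ) else 0)))).mulVec y)
          ≤ 0 := by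
  classical
  set v : Finset (Fin n) → Fin n → ℝ := fun S i => if i ∈ S then (1 : ℝ) else 0 with hv
  have key := aux_main
    (∑ S ∈ ℒ, (β S • Matrix.vecMulVec (v S) (v S) + βx S • Matrix.vecMulVec (x S) (x S)))
    (Matrix.posSemidef_sum _ fun S hS =>
      ((Matrix.posSemidef_vecMulVec_self_star (v S)).smul (hβ S hS)).add
      ((Matrix.posSemidef_vecMulVec_self_star (x S)).smul (hβx S hS)))
    (fun i => ∑ S ∈ ℒ, (β S + βx S) * v S i)
    (by
      intro i
      rw [Matrix.sum_apply]
      apply Finset.sum_le_sum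
      intro S hS
      simp only [Matrix.add_apply, Matrix.smul_apply, Matrix.vecMulVec_apply, smul_eq_mul]
      by_cases hi : i ∈ S
      · have h1 : v S i = 1 := by simp [hv, hi]
        have h2 : x S i * x S i ≤ 1 := by
          have := abs_le.1 (hbdd S hS i)
          nlinarith
        rw [h1]
        nlinarith [hβx S hS]
      · have h1 : v S i = 0 := by simp [hv, hi]
        rw [h1, hsupp S hS i hi]; simp)
  obtain ⟨W, hW, h⟩ := key
  refine ⟨W, hW, fun y hy => ?_⟩
  have h1 := h y hy
  have e : (∑ S ∈ ℒ, (β S • (Matrix.vecMulVec (v S) (v S) - 2 • Matrix.diagonal (v S)) +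
      βx S • (Matrix.vecMulVec (x S) (x S) - 2 • Matrix.diagonal (v S)))) =
      (∑ S ∈ ℒ, (β S • Matrix.vecMulVec (v S) (v S) + βx S • Matrix.vecMulVec (x S) (x S)))
      - (2 : ℝ) • Matrix.diagonal (fun i => ∑ S ∈ ℒ, (β S + βx S) * v S i) := by
    ext i j
    simp only [Matrix.sub_apply, Matrix.sum_apply, Matrix.smul_apply, Matrix.add_apply,
      Matrix.diagonal_apply, smul_eq_mul, two_nsmul]
    by_cases hij : i = j
    · simp only [hij, if_true, Finset.mul_sum, ← Finset.sum_sub_distrib]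
      refine Finset.sum_congr rfl fun S _ => ?_
      ring
    · simp [hij]
  change dotProduct y (Matrix.mulVec (∑ S ∈ ℒ, (β S • (Matrix.vecMulVec (v S) (v S) -
      2 • Matrix.diagonal (v S)) +
      βx S • (Matrix.vecMulVec (x S) (x S) - 2 • Matrix.diagonal (v S)))) y) ≤ 0
  rw [e, Matrix.sub_mulVec, dotProduct_sub, Matrix.smul_mulVec, dotProduct_smul]
  have e2 : dotProduct y (Matrix.mulVec
      (Matrix.diagonal (fun i => ∑ S ∈ ℒ, (β S + βx S) * v S i)) y) =
      ∑ i, (∑ S ∈ ℒ, (β S + βx S) * v S i) * y i ^ 2 := by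
    simp only [dotProduct, Matrix.mulVec_diagonal]
    exact Finset.sum_congr rfl fun i _ => by ring
  rw [e2, smul_eq_mul]
  linarith
end

section
/- Let X₁,…,X_n be independent random variables and let Y₀,Y₁,…,Y_n be a martingale with respect to X₁,…,X_n (each Y_k is a function of X₁,…,X_k, E[|Y_k|] < ∞, and E[Y_k | X₁,…,X_{k-1}] = Y_{k-1}) such that |Y_k − Y_{k-1}| ≤ M for all k. Define W_k = ∑_{j=1}^k E[(Y_j − Y_{j-1})² | X₁,…,X_{j-1}]. Then for all λ ≥ 0 and σ² ≥ 0, Pr[ |Y_n − Y_0| ≥ λ and W_n ≤ σ² ] ≤ 2·exp( −λ² / (2(σ² + Mλ/3)) ). -/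
open MeasureTheory ProbabilityTheory

lemma freedman_exp_le (x b : ℝ) (hx : |x| ≤ b) (hb : b < 3) :
    Real.exp x ≤ 1 + x + x ^ 2 / (2 * (1 - b / 3)) := by
  have hb0 : 0 ≤ b := (abs_nonneg x).trans hx
  have h1 : HasSum (fun n : ℕ => x ^ n / (n.factorial : ℝ)) (Real.exp x) := by
    rw [Real.exp_eq_exp_ℝ]
    exact NormedSpace.expSeries_div_hasSum_exp x
  have h2 := (hasSum_nat_add_iff' 2).2 h1
  have h3 : HasSum (fun n : ℕ => x ^ 2 / 2 * (b / 3) ^ n) (x ^ 2 / 2 * (1 - b / 3)⁻¹) :=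
    (hasSum_geometric_of_lt_one (by positivity) (by linarith)).mul_left _
  have h4 := hasSum_le (fun n => ?_) h2 h3
  · simp [Finset.sum_range_succ] at h4
    have : x ^ 2 / (2 * (1 - b / 3)) = x ^ 2 / 2 * (1 - b / 3)⁻¹ := by
      rw [div_mul_eq_div_div]; rfl
    rw [this]; linarith
  · have hf : (2 : ℝ) * 3 ^ n ≤ ((n + 2).factorial : ℝ) := by
      have := @Nat.factorial_mul_pow_le_factorial 2 n
      rw [add_comm n 2]
      exact_mod_cast this
    have hxn : x ^ n ≤ b ^ n := (le_abs_self _).trans (by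
      rw [abs_pow]; exact pow_le_pow_left₀ (abs_nonneg _) hx n)
    calc x ^ (n + 2) / ((n + 2).factorial : ℝ) = x ^ 2 * x ^ n / ((n + 2).factorial : ℝ) := by ring
      _ ≤ x ^ 2 * b ^ n / ((n + 2).factorial : ℝ) := by gcongr
      _ ≤ x ^ 2 * b ^ n / (2 * 3 ^ n) := by gcongr
      _ = x ^ 2 / 2 * (b / 3) ^ n := by rw [div_pow]; field_simp

lemma freedman_step {Ω : Type*} {m m0 : MeasurableSpace Ω}
    (μ : Measure Ω) [IsProbabilityMeasure μ] (hm : m ≤ m0)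
    (A D : Ω → ℝ) (hA : StronglyMeasurable[m] A) (C : ℝ) (hA0 : ∀ ω, 0 ≤ A ω)
    (hAC : ∀ᵐ ω ∂μ, A ω ≤ C) (M θ c : ℝ) (hD : Integrable D μ) (hDM : ∀ ω, |D ω| ≤ M)
    (hD0 : μ[D | m] =ᵐ[μ] 0)
    (hc : ∀ x, |x| ≤ M → Real.exp (θ * x) ≤ 1 + θ * x + c * x ^ 2)
    (hint : Integrable (fun ω => A ω * Real.exp (c * (μ[fun ω => D ω ^ 2 | m]) ω)) μ) :
    Integrable (fun ω => A ω * Real.exp (θ * D ω)) μ ∧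
    ∫ ω, A ω * Real.exp (θ * D ω) ∂μ ≤
      ∫ ω, A ω * Real.exp (c * (μ[fun ω => D ω ^ 2 | m]) ω) ∂μ := by
  have hAm : AEStronglyMeasurable A μ := (hA.mono hm).aestronglyMeasurable
  have hAb : ∀ᵐ ω ∂μ, ‖A ω‖ ≤ C := by
    filter_upwards [hAC] with ω h
    rwa [Real.norm_of_nonneg (hA0 ω)]
  have hD2 : Integrable (fun ω => D ω ^ 2) μ := by
    refine Integrable.of_bound (hD.aestronglyMeasurable.pow 2) (M ^ 2) (.of_forall fun ω => ?_)
    rw [Real.norm_eq_abs, abs_pow]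
    exact pow_le_pow_left₀ (abs_nonneg _) (hDM ω) 2
  have hE : Integrable (fun ω => Real.exp (θ * D ω)) μ := by
    refine Integrable.of_bound (Real.continuous_exp.comp_aestronglyMeasurable
      (hD.aestronglyMeasurable.const_mul θ)) (Real.exp (|θ| * M)) (.of_forall fun ω => ?_)
    rw [Real.norm_eq_abs, Real.abs_exp, Real.exp_le_exp]
    refine (le_abs_self _).trans ?_
    rw [abs_mul]
    exact mul_le_mul_of_nonneg_left (hDM ω) (abs_nonneg _)
  have hAE := hE.bdd_mul hAm hAb
  refine ⟨hAE, ?_⟩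
  have iA : Integrable A μ := Integrable.of_bound hAm C hAb
  have iAD : Integrable (A * D) μ := hD.bdd_mul hAm hAb
  have iAD2 : Integrable (A * fun ω => D ω ^ 2) μ := hD2.bdd_mul hAm hAb
  have iAV : Integrable (A * μ[fun ω => D ω ^ 2 | m]) μ :=
    integrable_condExp.bdd_mul hAm hAb
  have e1 : ∫ ω, (A * D) ω ∂μ = 0 := by
    rw [← integral_condExp hm]
    refine integral_eq_zero_of_ae ?_
    filter_upwards [condExp_mul_of_stronglyMeasurable_left hA iAD hD, hD0] with ω h1 h2
    rw [h1, Pi.mul_apply, h2]; simp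
  have e2 : ∫ ω, (A * fun ω => D ω ^ 2) ω ∂μ = ∫ ω, (A * μ[fun ω => D ω ^ 2 | m]) ω ∂μ := by
    rw [← integral_condExp hm]
    exact integral_congr_ae (condExp_mul_of_stronglyMeasurable_left hA iAD2 hD2)
  calc ∫ ω, A ω * Real.exp (θ * D ω) ∂μ
      ≤ ∫ ω, (A ω + θ * (A * D) ω) + c * (A * fun ω => D ω ^ 2) ω ∂μ := by
        refine integral_mono hAE ((iA.add (iAD.const_mul θ)).add (iAD2.const_mul c)) fun ω => ?_
        have := mul_le_mul_of_nonneg_left (hc _ (hDM ω)) (hA0 ω)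
        simp only [Pi.mul_apply]
        linarith
    _ = ∫ ω, A ω + c * (A * μ[fun ω => D ω ^ 2 | m]) ω ∂μ := by
        have iS : Integrable (fun ω => A ω + θ * (A * D) ω) μ := iA.add (iAD.const_mul θ)
        rw [integral_add iS (iAD2.const_mul c),
          integral_add iA (iAD.const_mul θ), integral_add iA (iAV.const_mul c),
          integral_const_mul, integral_const_mul, integral_const_mul, e1, e2]
        ring
    _ ≤ _ := by
        refine integral_mono (iA.add (iAV.const_mul c)) hint fun ω => ?_
        have := mul_le_mul_of_nonneg_left
          (Real.add_one_le_exp (c * (μ[fun ω => D ω ^ 2 | m]) ω)) (hA0 ω)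
        simp only [Pi.mul_apply]
        linarith

lemma freedman_supermart {Ω : Type*} [m0 : MeasurableSpace Ω]
    (μ : Measure Ω) [IsProbabilityMeasure μ]
    (ℱ : Filtration ℕ m0) (Y : ℕ → Ω → ℝ) (hY : Martingale Y ℱ μ)
    (M : ℝ) (hM : ∀ k ω, |Y (k + 1) ω - Y k ω| ≤ M)
    (V : ℕ → Ω → ℝ) (hV : ∀ k, V k = μ[fun ω => (Y (k + 1) ω - Y k ω) ^ 2 | ℱ k])
    (θ c : ℝ) (hθ : 0 ≤ θ) (hc0 : 0 ≤ c)
    (hc : ∀ x, |x| ≤ M → Real.exp (θ * x) ≤ 1 + θ * x + c * x ^ 2) (k : ℕ) :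
    Integrable (fun ω => Real.exp (θ * (Y k ω - Y 0 ω) - c * ∑ j ∈ Finset.range k, V j ω)) μ ∧
    ∫ ω, Real.exp (θ * (Y k ω - Y 0 ω) - c * ∑ j ∈ Finset.range k, V j ω) ∂μ ≤ 1 := by
  have hVm : ∀ j, StronglyMeasurable[ℱ j] (V j) := fun j => by
    rw [hV]; exact stronglyMeasurable_condExp
  have hV0 : ∀ᵐ ω ∂μ, ∀ j, 0 ≤ V j ω := by
    rw [ae_all_iff]
    intro j
    rw [hV]
    exact condExp_nonneg (.of_forall fun ω => sq_nonneg _)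
  have hYb : ∀ k ω, Y k ω - Y 0 ω ≤ k * M := by
    intro k ω
    induction k with
    | zero => simp
    | succ k ih =>
      have := (abs_le.1 (hM k ω)).2
      push_cast; linarith
  induction k with
  | zero => simp
  | succ k ih =>
    let A : Ω → ℝ := fun ω =>
      Real.exp (θ * (Y k ω - Y 0 ω) - c * ∑ j ∈ Finset.range (k + 1), V j ω)
    have hA : StronglyMeasurable[ℱ k] A := by
      refine Real.continuous_exp.comp_stronglyMeasurable ?_
      refine StronglyMeasurable.sub ?_ ?_
      · exact ((hY.stronglyAdapted k).sub
          ((hY.stronglyAdapted 0).mono (ℱ.mono (Nat.zero_le k)))).const_mul θ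
      · refine StronglyMeasurable.const_mul ?_ c
        refine Finset.stronglyMeasurable_fun_sum _ fun j hj => ?_
        exact (hVm j).mono (ℱ.mono (by simp at hj; omega))
    have hAV : (fun ω => A ω * Real.exp (c * (μ[fun ω => (Y (k + 1) ω - Y k ω) ^ 2 | ℱ k]) ω))
        = fun ω => Real.exp (θ * (Y k ω - Y 0 ω) - c * ∑ j ∈ Finset.range k, V j ω) := by
      funext ω
      rw [← hV, ← Real.exp_add, Finset.sum_range_succ]
      congr 1; ring
    have hAD : (fun ω => A ω * Real.exp (θ * (Y (k + 1) ω - Y k ω))) = fun ω =>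
        Real.exp (θ * (Y (k + 1) ω - Y 0 ω) - c * ∑ j ∈ Finset.range (k + 1), V j ω) := by
      funext ω
      rw [← Real.exp_add]
      congr 1; ring
    have key := freedman_step μ (ℱ.le k) A (fun ω => Y (k + 1) ω - Y k ω) hA
      (Real.exp (θ * (k * M))) (fun ω => (Real.exp_pos _).le) ?_ M θ c
      ((hY.integrable (k + 1)).sub (hY.integrable k)) (hM k) ?_ hc (by rw [hAV]; exact ih.1)
    · rw [hAV, hAD] at key
      exact ⟨key.1, key.2.trans ih.2⟩
    · filter_upwards [hV0] with ω h
      rw [Real.exp_le_exp]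
      have h1 : 0 ≤ c * ∑ j ∈ Finset.range (k + 1), V j ω :=
        mul_nonneg hc0 (Finset.sum_nonneg fun j _ => h j)
      have h2 := mul_le_mul_of_nonneg_left (hYb k ω) hθ
      linarith
    · have h1 := condExp_sub (hY.integrable (k + 1)) (hY.integrable k) (ℱ k)
      filter_upwards [h1, hY.condExp_ae_eq (Nat.le_succ k), hY.condExp_ae_eq (le_refl k)]
        with ω h1 h2 h3
      have h4 : (μ[fun ω => Y (k + 1) ω - Y k ω | ℱ k]) ω = _ := h1
      rw [h4, Pi.sub_apply, h2, h3]; simp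

lemma freedman_tail {Ω : Type*} [m0 : MeasurableSpace Ω]
    (μ : Measure Ω) [IsProbabilityMeasure μ]
    (ℱ : Filtration ℕ m0) (Y : ℕ → Ω → ℝ) (hY : Martingale Y ℱ μ)
    (M : ℝ) (hM : ∀ k ω, |Y (k + 1) ω - Y k ω| ≤ M)
    (V : ℕ → Ω → ℝ) (hV : ∀ k, V k = μ[fun ω => (Y (k + 1) ω - Y k ω) ^ 2 | ℱ k])
    (n : ℕ) (lam σ2 θ c : ℝ) (hθ : 0 ≤ θ) (hc0 : 0 ≤ c)
    (hc : ∀ x, |x| ≤ M → Real.exp (θ * x) ≤ 1 + θ * x + c * x ^ 2) :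
    μ.real {ω | lam ≤ Y n ω - Y 0 ω ∧ ∑ j ∈ Finset.range n, V j ω ≤ σ2} ≤
      Real.exp (-(θ * lam - c * σ2)) := by
  obtain ⟨h1, h2⟩ := freedman_supermart μ ℱ Y hY M hM V hV θ c hθ hc0 hc n
  have h3 := mul_meas_ge_le_integral_of_nonneg (.of_forall fun ω => (Real.exp_pos _).le) h1
    (Real.exp (θ * lam - c * σ2))
  have h4 : μ.real {ω | lam ≤ Y n ω - Y 0 ω ∧ ∑ j ∈ Finset.range n, V j ω ≤ σ2} ≤
      μ.real {ω | Real.exp (θ * lam - c * σ2) ≤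
        Real.exp (θ * (Y n ω - Y 0 ω) - c * ∑ j ∈ Finset.range n, V j ω)} := by
    refine measureReal_mono ?_
    rintro ω ⟨ha, hb⟩
    simp only [Set.mem_ofPred_eq, Real.exp_le_exp]
    have := mul_le_mul_of_nonneg_left ha hθ
    have := mul_le_mul_of_nonneg_left hb hc0
    linarith
  refine h4.trans ?_
  rw [Real.exp_neg, ← one_div, le_div_iff₀ (Real.exp_pos _), mul_comm]
  exact h3.trans h2

lemma freedman_param (M lam σ2 : ℝ) (hM : 0 ≤ M) (hlam : 0 ≤ lam) (hσ2 : 0 ≤ σ2)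
    (hs : 0 < σ2 + M * lam / 3) :
    ∃ θ c : ℝ, 0 ≤ θ ∧ 0 ≤ c ∧
      (∀ x, |x| ≤ M → Real.exp (θ * x) ≤ 1 + θ * x + c * x ^ 2) ∧
      -(θ * lam - c * σ2) = -lam ^ 2 / (2 * (σ2 + M * lam / 3)) := by
  have main : ∀ θ : ℝ, 0 ≤ θ → θ * M < 3 → 0 ≤ θ ^ 2 / (2 * (1 - θ * M / 3)) ∧
      ∀ x, |x| ≤ M → Real.exp (θ * x) ≤ 1 + θ * x + θ ^ 2 / (2 * (1 - θ * M / 3)) * x ^ 2 := by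
    intro θ h0 h3
    refine ⟨div_nonneg (sq_nonneg _) (by linarith), fun x hx => ?_⟩
    have := freedman_exp_le (θ * x) (θ * M) (by
      rw [abs_mul, abs_of_nonneg h0]; exact mul_le_mul_of_nonneg_left hx h0) h3
    rw [mul_pow, mul_div_right_comm] at this
    exact this
  rcases hσ2.eq_or_lt with h | h
  · subst h
    have hp : 0 < M * lam := by linarith
    have hM' : 0 < M := pos_of_mul_pos_left hp hlam
    have hl' : 0 < lam := pos_of_mul_pos_right hp hM
    have h3 : 3 / (2 * M) * M < 3 := by
      have : 3 / (2 * M) * M = 3 / 2 := by field_simp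
      rw [this]; norm_num
    obtain ⟨a, b⟩ := main (3 / (2 * M)) (by positivity) h3
    refine ⟨_, _, by positivity, a, b, ?_⟩
    rw [mul_zero]
    field_simp
    ring
  · have e : lam / (σ2 + M * lam / 3) * M = 3 * (1 - σ2 / (σ2 + M * lam / 3)) := by
      field_simp
      ring
    have hpos : 0 < σ2 / (σ2 + M * lam / 3) := by positivity
    obtain ⟨a, b⟩ := main (lam / (σ2 + M * lam / 3)) (by positivity) (by rw [e]; linarith)
    refine ⟨_, _, by positivity, a, b, ?_⟩
    have e2 : 1 - lam / (σ2 + M * lam / 3) * M / 3 = σ2 / (σ2 + M * lam / 3) := by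
      rw [e]; ring
    rw [e2]
    generalize σ2 + M * lam / 3 = s at *
    field_simp
    ring

/-- Freedman's martingale concentration inequality: if `Y₀,…,Y_n` is a
martingale with respect to the filtration generated by independent random
variables `X₁,…,X_n`, with increments bounded by `M`, and
`W_k = ∑_{j=1}^k E[(Y_j − Y_{j-1})² | X₁,…,X_{j-1}]`, then for all `lam ≥ 0`
and `σ² ≥ 0`,
`Pr[|Y_n − Y₀| ≥ lam and W_n ≤ σ²] ≤ 2 exp(−lam² / (2(σ² + M·lam/3)))`. -/
theorem freedman_inequality {Ω : Type*} [m0 : MeasurableSpace Ω]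
    (μ : Measure Ω) [IsProbabilityMeasure μ] (n : ℕ)
    (X : ℕ → Ω → ℝ) (hXmeas : ∀ j, Measurable (X j))
    (hindep : iIndepFun X μ)
    (ℱ : Filtration ℕ m0)
    (hℱ : ∀ k, ℱ k = ⨆ j ∈ Finset.Icc 1 k, MeasurableSpace.comap (X j) inferInstance)
    (Y : ℕ → Ω → ℝ) (hY : Martingale Y ℱ μ)
    (M : ℝ) (hM : ∀ k, 1 ≤ k → ∀ ω, |Y k ω - Y (k - 1) ω| ≤ M)
    (W : ℕ → Ω → ℝ)
    (hW : ∀ k, W k =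
      fun ω => ∑ j ∈ Finset.Icc 1 k, (μ[fun ω' => (Y j ω' - Y (j - 1) ω') ^ 2 | ℱ (j - 1)]) ω)
    (lam σ2 : ℝ) (hlam : 0 ≤ lam) (hσ2 : 0 ≤ σ2) :
    (μ {ω | lam ≤ |Y n ω - Y 0 ω| ∧ W n ω ≤ σ2}).toReal ≤
      2 * Real.exp (-lam ^ 2 / (2 * (σ2 + M * lam / 3))) := by
  have hne : Nonempty Ω := by
    by_contra h
    rw [not_nonempty_iff] at h
    have := IsProbabilityMeasure.measure_univ (μ := μ)
    simp [Set.eq_empty_of_isEmpty] at this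
  have hM0 : 0 ≤ M := (abs_nonneg _).trans (hM 1 le_rfl hne.some)
  have hM' : ∀ k ω, |Y (k + 1) ω - Y k ω| ≤ M := fun k ω => by
    simpa using hM (k + 1) (by omega) ω
  have hs : 0 ≤ σ2 + M * lam / 3 := by positivity
  rcases hs.eq_or_lt with hs | hs
  · rw [← hs]
    have : μ.real {ω | lam ≤ |Y n ω - Y 0 ω| ∧ W n ω ≤ σ2} ≤ 1 := measureReal_le_one
    simp only [mul_zero, div_zero, Real.exp_zero]
    exact this.trans (by norm_num)
  obtain ⟨θ, c, hθ, hc0, hc, hE⟩ := freedman_param M lam σ2 hM0 hlam hσ2 hs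
  let V : ℕ → Ω → ℝ := fun k => μ[fun ω => (Y (k + 1) ω - Y k ω) ^ 2 | ℱ k]
  have hWV : ∀ ω, W n ω = ∑ j ∈ Finset.range n, V j ω := by
    intro ω
    rw [hW]
    simp only [V]
    rw [Finset.range_eq_Ico]
    have := Finset.sum_Ico_add'
      (fun j => (μ[fun ω' => (Y j ω' - Y (j - 1) ω') ^ 2 | ℱ (j - 1)]) ω) 0 n 1
    simp only [Nat.add_sub_cancel, zero_add] at this
    rw [this]
    rfl
  have t1 := freedman_tail μ ℱ Y hY M hM' V (fun k => rfl) n lam σ2 θ c hθ hc0 hc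
  have t2 := freedman_tail μ ℱ (-Y) hY.neg M (fun k ω => by
      have := hM' k ω
      rw [abs_sub_comm] at this
      simp only [Pi.neg_apply]
      convert this using 2
      ring) V (fun k => by
      simp only [V, Pi.neg_apply]
      congr 1
      funext ω
      ring) n lam σ2 θ c hθ hc0 hc
  rw [hE] at t1 t2
  have hsub : {ω | lam ≤ |Y n ω - Y 0 ω| ∧ W n ω ≤ σ2} ⊆
      {ω | lam ≤ Y n ω - Y 0 ω ∧ ∑ j ∈ Finset.range n, V j ω ≤ σ2} ∪
      {ω | lam ≤ (-Y) n ω - (-Y) 0 ω ∧ ∑ j ∈ Finset.range n, V j ω ≤ σ2} := by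
    rintro ω ⟨h1, h2⟩
    rw [hWV] at h2
    rcases le_abs.1 h1 with h | h
    · exact Or.inl ⟨h, h2⟩
    · refine Or.inr ⟨?_, h2⟩
      simp only [Pi.neg_apply]
      linarith
  have := (measureReal_mono (μ := μ) hsub).trans (measureReal_union_le _ _)
  rw [two_mul]
  exact this.trans (add_le_add t1 t2)
end
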